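/- Writing |B_{2n}/(2n)| = τ_n/β_n in lowest terms, the numerator sequence (τ_n)_{n≥1} is realizable. -/

import Mathlib

/-- A sequence `a : ℕ → ℕ` (indexed from 1) is realizable if there is a set `X`
and a map `T : X → X` such that for every `n ≥ 1` the set of points fixed by the
`n`-th iterate of `T` is finite with cardinality `a n`. -/
def IsRealizable (a : ℕ → ℕ) : Prop :=
  ∃ (X : Type) (T : X → X), ∀ n : ℕ, 1 ≤ n →
    {x : X | T^[n] x = x}.Finite ∧ {x : X | T^[n] x = x}.ncard = a n

/-- The Möbius-transformed sum `∑_{d ∣ n} μ(n/d) a_d`. -/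
def doldSum (a : ℕ → ℕ) (n : ℕ) : ℤ :=
  ∑ d ∈ n.divisors, (ArithmeticFunction.moebius (n / d) : ℤ) * (a d : ℤ)

/-- The numerator `τ_n` of `|B_{2n}/(2n)|` in lowest terms. -/
def bernoulliTau (n : ℕ) : ℕ := (|bernoulli (2 * n) / (2 * n : ℚ)|).num.natAbs

/-- The denominator `β_n` of `|B_{2n}/(2n)|` in lowest terms. -/
def bernoulliBeta (n : ℕ) : ℕ := (|bernoulli (2 * n) / (2 * n : ℚ)|).den

section Dold

lemma doldSum_inversion (a : ℕ → ℕ) {n : ℕ} (hn : 0 < n) :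
    ∑ d ∈ n.divisors, doldSum a d = (a n : ℤ) := by
  have := (ArithmeticFunction.sum_eq_iff_sum_mul_moebius_eq (R := ℤ)
    (f := fun n => doldSum a n) (g := fun n => (a n : ℤ))).2 ?_ n hn
  · exact this
  · intro n hn
    rw [doldSum, ← Nat.map_div_left_divisors]
    rw [← Nat.sum_divisorsAntidiagonal' (f := fun x y => (ArithmeticFunction.moebius x : ℤ) * (a y : ℤ))]
    simp [Nat.map_div_left_divisors]

lemma realizable_of_dold (a : ℕ → ℕ) (h0 : ∀ n, 1 ≤ n → 0 ≤ doldSum a n)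
    (h1 : ∀ n : ℕ, 1 ≤ n → (n : ℤ) ∣ doldSum a n) : IsRealizable a := by
  classical
  set o : ℕ → ℕ := fun n => (doldSum a n).toNat / n with ho
  have ho' : ∀ n, 1 ≤ n → ((o n * n : ℕ) : ℤ) = doldSum a n := by
    intro n hn
    have : n ∣ (doldSum a n).toNat := by
      rw [← Int.natCast_dvd_natCast, Int.toNat_of_nonneg (h0 n hn)]; exact h1 n hn
    rw [ho]
    simp only
    rw [Nat.div_mul_cancel this, Int.toNat_of_nonneg (h0 n hn)]
  refine ⟨Σ n : ℕ, Fin (o n) × ZMod n, fun x => ⟨x.1, x.2.1, x.2.2 + 1⟩, ?_⟩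
  intro m hm
  have hit : ∀ k : ℕ, ∀ x : (Σ n : ℕ, Fin (o n) × ZMod n),
      (fun x : (Σ n : ℕ, Fin (o n) × ZMod n) => (⟨x.1, x.2.1, x.2.2 + 1⟩ :
        (Σ n : ℕ, Fin (o n) × ZMod n)))^[k] x = ⟨x.1, x.2.1, x.2.2 + k⟩ := by
    intro k
    induction k with
    | zero => intro x; simp
    | succ k ih =>
      intro x
      rw [Function.iterate_succ_apply', ih]
      simp [add_assoc]
  have hne : ∀ n : ℕ, n ∈ m.divisors → NeZero n := fun n hn => ⟨(Nat.pos_of_mem_divisors hn).ne'⟩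
  have hset : {x : (Σ n : ℕ, Fin (o n) × ZMod n) |
      (fun x : (Σ n : ℕ, Fin (o n) × ZMod n) => (⟨x.1, x.2.1, x.2.2 + 1⟩ :
        (Σ n : ℕ, Fin (o n) × ZMod n)))^[m] x = x} =
      ⋃ n ∈ m.divisors, (Sigma.mk n) '' (Set.univ : Set (Fin (o n) × ZMod n)) := by
    ext ⟨n, i, z⟩
    simp only [Set.mem_ofPred_eq, hit, Set.mem_iUnion, Set.mem_image, Set.mem_univ, true_and]
    have : ((⟨n, i, z + m⟩ : (Σ n : ℕ, Fin (o n) × ZMod n)) = ⟨n, i, z⟩) ↔ n ∣ m := by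
      rw [← ZMod.natCast_eq_zero_iff]
      simp
    rw [this]
    constructor
    · intro h
      exact ⟨n, by simp [h]; omega, (i, z), rfl⟩
    · rintro ⟨n', h, y, hy⟩
      have : n' = n := congrArg Sigma.fst hy
      subst this
      exact Nat.dvd_of_mem_divisors h
  rw [hset]
  have hfin : ∀ n ∈ m.divisors, ((Sigma.mk n) '' (Set.univ : Set (Fin (o n) × ZMod n)) :
      Set (Σ n : ℕ, Fin (o n) × ZMod n)).Finite := by
    intro n hn
    have := hne n hn
    exact Set.Finite.image _ Set.finite_univ
  refine ⟨Set.Finite.biUnion (Finset.finite_toSet _) hfin, ?_⟩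
  have hF : (⋃ n ∈ m.divisors, ((Sigma.mk n) '' (Set.univ : Set (Fin (o n) × ZMod n)) :
      Set (Σ n : ℕ, Fin (o n) × ZMod n))).ncard = ∑ n ∈ m.divisors, o n * n := by
    have hgen : ∀ s : Finset ℕ, s ⊆ m.divisors →
        (⋃ n ∈ s, ((Sigma.mk n) '' (Set.univ : Set (Fin (o n) × ZMod n)) :
          Set (Σ n : ℕ, Fin (o n) × ZMod n))).ncard = ∑ n ∈ s, o n * n := by
      intro s
      induction s using Finset.induction_on with
      | empty => intro _; simp
      | insert n s hns ih =>
        intro hs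
        have hn : n ∈ m.divisors := hs (Finset.mem_insert_self _ _)
        have hs' : s ⊆ m.divisors := fun x hx => hs (Finset.mem_insert_of_mem hx)
        have := hne n hn
        have hfs : (⋃ n ∈ s, ((Sigma.mk n) '' (Set.univ : Set (Fin (o n) × ZMod n)) :
            Set (Σ n : ℕ, Fin (o n) × ZMod n))).Finite :=
          Set.Finite.biUnion (Finset.finite_toSet _) (fun i hi => hfin i (hs' hi))
        rw [Finset.set_biUnion_insert, Set.ncard_union_eq ?_ (hfin n hn) hfs, ih hs', Finset.sum_insert hns,
          Set.ncard_image_of_injective _ sigma_mk_injective, Set.ncard_univ]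
        · simp
        · rw [Set.disjoint_left]
          rintro _ ⟨y, _, rfl⟩ h2
          simp only [Set.mem_iUnion] at h2
          obtain ⟨n', hn', y', _, h⟩ := h2
          have : n' = n := congrArg Sigma.fst h
          exact hns (this ▸ hn')
    exact hgen _ (Finset.Subset.refl _)
  rw [hF]
  zify
  rw [← doldSum_inversion a hm]
  refine Finset.sum_congr rfl fun n hn => ?_
  rw [← ho' n (Nat.pos_of_mem_divisors hn)]
  push_cast; rfl

lemma dold_dvd (a : ℕ → ℕ) (h : ∀ p k m : ℕ, p.Prime → 1 ≤ m → ¬ p ∣ m →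
    ((p : ℤ) ^ (k + 1)) ∣ (a (p ^ (k + 1) * m) : ℤ) - a (p ^ k * m)) :
    ∀ n : ℕ, 1 ≤ n → (n : ℤ) ∣ doldSum a n := by
  intro n hn
  have key : ∀ p k : ℕ, p.Prime → p ^ k ∣ n → ((p : ℤ) ^ k) ∣ doldSum a n := by
    intro p k hp hk
    obtain ⟨e, m, hm, rfl⟩ := Nat.exists_eq_pow_mul_and_not_dvd (n := n) (by omega) p hp.ne_one
    have hmpos : 1 ≤ m := by
      rcases Nat.eq_zero_or_pos m with h | h
      · simp [h] at hm
      · exact h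
    have hcop : ∀ j, Nat.Coprime (p ^ j) m := fun j =>
      Nat.Coprime.pow_left _ ((Nat.Prime.coprime_iff_not_dvd hp).2 hm)
    have hke : k ≤ e := by
      have := (Nat.Coprime.dvd_mul_right (hcop k)).1 hk
      exact (Nat.pow_dvd_pow_iff_le_right hp.one_lt).1 this
    rcases e with _ | e
    · obtain rfl : k = 0 := by omega
      simp
    refine dvd_trans (pow_dvd_pow _ hke) ?_
    have : doldSum a (p ^ (e + 1) * m) = ∑ d ∈ m.divisors,
        (ArithmeticFunction.moebius (m / d) : ℤ) * ((a (p ^ (e + 1) * d) : ℤ) - a (p ^ e * d)) := by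
      rw [doldSum, Nat.divisors_mul, Finset.mul_def,
        Finset.sum_image ((hcop (e + 1)).mul_injOn_divisors), Finset.sum_product_right]
      refine Finset.sum_congr rfl fun d hd => ?_
      have hdm := Nat.dvd_of_mem_divisors hd
      rw [Nat.divisors_prime_pow hp, Finset.sum_map]
      have hterm : ∀ i ∈ Finset.range (e + 1 + 1),
          (ArithmeticFunction.moebius (p ^ (e + 1) * m / (p ^ i * d)) : ℤ) * (a (p ^ i * d) : ℤ)
          = ArithmeticFunction.moebius (p ^ (e + 1 - i)) *
            (ArithmeticFunction.moebius (m / d) * (a (p ^ i * d) : ℤ)) := by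
        intro i hi
        have hi' : i ≤ e + 1 := by simpa [Nat.lt_succ_iff] using hi
        rw [← Nat.div_mul_div_comm (pow_dvd_pow p hi') hdm, Nat.pow_div hi' hp.pos,
          ArithmeticFunction.isMultiplicative_moebius.map_mul_of_coprime]
        · ring
        · exact Nat.Coprime.coprime_dvd_right (Nat.div_dvd_of_dvd hdm) (hcop _)
      simp only [Function.Embedding.coeFn_mk]
      rw [Finset.sum_congr rfl hterm, Finset.sum_range_succ, Finset.sum_range_succ,
        Finset.sum_eq_zero]
      · simp [ArithmeticFunction.moebius_apply_prime hp]
        ring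
      · intro i hi
        have hi' : i < e := by simpa using hi
        rw [ArithmeticFunction.moebius_apply_prime_pow hp (by omega), if_neg (by omega), zero_mul]
    rw [this]
    refine Finset.dvd_sum fun d hd => Dvd.dvd.mul_left (h p e d hp (Nat.pos_of_mem_divisors hd) ?_) _
    exact fun hpd => hm (hpd.trans (Nat.dvd_of_mem_divisors hd))
  have : n ∣ (doldSum a n).natAbs := by
    rw [Nat.dvd_iff_prime_pow_dvd_dvd]
    intro p k hp hk
    have := key p k hp hk
    rw [← Int.natCast_dvd]
    exact_mod_cast this
  exact Int.natCast_dvd.2 this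

end Dold
section Analytic

open scoped Nat

/-- The rational number `|B_{2n}/(2n)|`. -/
def absb (n : ℕ) : ℚ := |bernoulli (2 * n) / (2 * n : ℚ)|

lemma exists_zeta (n : ℕ) (hn : 1 ≤ n) : ∃ z : ℝ, 1 ≤ z ∧ z ≤ 2 ∧
    z = (-1 : ℝ) ^ (n + 1) * (2 : ℝ) ^ (2 * n - 1) * Real.pi ^ (2 * n) *
        bernoulli (2 * n) / (2 * n)! := by
  have h := hasSum_zeta_nat (k := n) (by omega)
  refine ⟨_, ?_, ?_, rfl⟩
  · have := le_hasSum h 1 (fun j _ => by positivity)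
    simpa using this
  · have h2 := hasSum_zeta_two
    have : (∀ i : ℕ, 1 / (i : ℝ) ^ (2 * n) ≤ 1 / (i : ℝ) ^ 2) := by
      intro i
      rcases Nat.eq_zero_or_pos i with rfl | hi
      · simp [show n ≠ 0 by omega]
      · have : (1 : ℝ) ≤ i := by exact_mod_cast hi
        gcongr
        omega
    refine (hasSum_le this h h2).trans ?_
    nlinarith [Real.pi_lt_d2, Real.pi_pos]

lemma sign_bernoulli (n : ℕ) (hn : 1 ≤ n) :
    0 < (-1 : ℚ) ^ (n + 1) * (bernoulli (2 * n) / (2 * n : ℚ)) := by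
  obtain ⟨z, h1, h2, hz⟩ := exists_zeta n hn
  have hf : (0 : ℝ) < (2 * n)! := by exact_mod_cast Nat.factorial_pos _
  have hn' : (0 : ℝ) < n := by exact_mod_cast hn
  have : (0 : ℝ) < (-1 : ℝ) ^ (n + 1) * (bernoulli (2 * n) / (2 * n : ℝ)) := by
    have e : (-1 : ℝ) ^ (n + 1) * (bernoulli (2 * n) / (2 * n : ℝ)) =
      z * (2 * n)! / (2 ^ (2 * n - 1) * Real.pi ^ (2 * n) * (2 * n)) := by
      rw [hz]; field_simp
    rw [e]
    positivity
  exact_mod_cast this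

lemma absb_eq (n : ℕ) (hn : 1 ≤ n) :
    absb n = (-1 : ℚ) ^ (n + 1) * (bernoulli (2 * n) / (2 * n : ℚ)) := by
  have h := sign_bernoulli n hn
  rw [← abs_of_pos h, abs_mul, abs_pow]
  simp [absb]

lemma absb_pos (n : ℕ) (hn : 1 ≤ n) : 0 < absb n := by
  rw [absb_eq n hn]; exact sign_bernoulli n hn

lemma absb_zeta (n : ℕ) (hn : 1 ≤ n) : ∃ z : ℝ, 1 ≤ z ∧ z ≤ 2 ∧
    (absb n : ℝ) = z * (2 * n - 1)! / (2 ^ (2 * n - 1) * Real.pi ^ (2 * n)) := by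
  obtain ⟨z, h1, h2, hz⟩ := exists_zeta n hn
  refine ⟨z, h1, h2, ?_⟩
  have hn' : (0 : ℝ) < n := by exact_mod_cast hn
  have hff : ((2 * n)! : ℝ) = (2 * n) * (2 * n - 1)! := by
    obtain ⟨m, rfl⟩ : ∃ m, n = m + 1 := ⟨n - 1, by omega⟩
    have : 2 * (m + 1) - 1 = 2 * m + 1 := by omega
    rw [this, show 2 * (m + 1) = (2 * m + 1) + 1 by ring, Nat.factorial_succ]
    push_cast; ring
  have hf : (0 : ℝ) < (2 * n - 1)! := by exact_mod_cast Nat.factorial_pos _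
  rw [absb_eq n hn, hz, hff]
  push_cast
  field_simp

lemma absb_growth (n : ℕ) (hn : 8 ≤ n) : 2 * absb n ≤ absb (n + 1) := by
  obtain ⟨z, h1, h2, hz⟩ := absb_zeta n (by omega)
  obtain ⟨z', h1', h2', hz'⟩ := absb_zeta (n + 1) (by omega)
  have hf : (0 : ℝ) < (2 * n - 1)! := by exact_mod_cast Nat.factorial_pos _
  have key : (2 : ℝ) * absb n ≤ absb (n + 1) := by
    rw [hz, hz']
    have e1 : 2 * (n + 1) - 1 = (2 * n - 1) + 2 := by omega
    have e2 : ((2 * n - 1 + 2)! : ℝ) = (2 * n + 1) * (2 * n) * (2 * n - 1)! := by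
      rw [Nat.factorial_succ, Nat.factorial_succ]
      rw [show 2 * n - 1 + 1 = 2 * n by omega]
      push_cast; ring
    rw [e1, e2]
    have hn' : (8 : ℝ) ≤ n := by exact_mod_cast hn
    have hpi : Real.pi ^ 2 ≤ 10 := by nlinarith [Real.pi_lt_d2, Real.pi_pos]
    have e3 : z' * ((2 * n + 1) * (2 * n) * (2 * n - 1)!) /
        (2 ^ (2 * n - 1 + 2) * Real.pi ^ (2 * (n + 1))) =
        (z' * ((2 * n + 1) * (2 * n)) / (4 * Real.pi ^ 2)) *
          ((2 * n - 1)! / (2 ^ (2 * n - 1) * Real.pi ^ (2 * n))) := by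
      rw [pow_add, show 2 * (n + 1) = 2 * n + 2 by ring, pow_add]
      field_simp
      ring
    rw [e3, mul_div_assoc, ← mul_assoc]
    have : 2 * z ≤ z' * ((2 * n + 1) * (2 * n)) / (4 * Real.pi ^ 2) := by
      rw [le_div_iff₀ (by positivity)]
      have : (272 : ℝ) ≤ (2 * n + 1) * (2 * n) := by nlinarith
      have h3 : 2 * z * (4 * Real.pi ^ 2) ≤ 4 * (4 * 10) := by gcongr; linarith
      nlinarith
    gcongr
  exact_mod_cast key

lemma bern_vals : bernoulli 2 = 1/6 ∧ bernoulli 4 = -1/30 ∧ bernoulli 6 = 1/42 ∧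
    bernoulli 8 = -1/30 ∧ bernoulli 10 = 5/66 ∧ bernoulli 12 = -691/2730 ∧
    bernoulli 14 = 7/6 ∧ bernoulli 16 = -3617/510 := by
  have o : ∀ n, Odd n → 1 < n → bernoulli' n = 0 := fun n h1 h2 => bernoulli'_eq_zero_of_odd h1 h2
  have h3 := o 3 (by decide) (by norm_num)
  have h5 := o 5 (by decide) (by norm_num)
  have h7 := o 7 (by decide) (by norm_num)
  have h9 := o 9 (by decide) (by norm_num)
  have h11 := o 11 (by decide) (by norm_num)
  have h13 := o 13 (by decide) (by norm_num)
  have h15 := o 15 (by decide) (by norm_num)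
  have h6 : bernoulli' 6 = 1/42 := by
    rw [bernoulli'_def]
    simp only [Finset.sum_range_succ, Finset.sum_range_zero, bernoulli'_zero, bernoulli'_one, bernoulli'_two, h3, bernoulli'_four, h5]
    norm_num [Nat.choose]
  have h8 : bernoulli' 8 = -1/30 := by
    rw [bernoulli'_def]
    simp only [Finset.sum_range_succ, Finset.sum_range_zero, bernoulli'_zero, bernoulli'_one, bernoulli'_two, h3, bernoulli'_four, h5, h6, h7]
    norm_num [Nat.choose]
  have h10 : bernoulli' 10 = 5/66 := by
    rw [bernoulli'_def]
    simp only [Finset.sum_range_succ, Finset.sum_range_zero, bernoulli'_zero, bernoulli'_one, bernoulli'_two, h3, bernoulli'_four, h5, h6, h7, h8, h9]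
    norm_num [Nat.choose]
  have h12 : bernoulli' 12 = -691/2730 := by
    rw [bernoulli'_def]
    simp only [Finset.sum_range_succ, Finset.sum_range_zero, bernoulli'_zero, bernoulli'_one, bernoulli'_two, h3, bernoulli'_four, h5, h6, h7, h8, h9, h10, h11]
    norm_num [Nat.choose]
  have h14 : bernoulli' 14 = 7/6 := by
    rw [bernoulli'_def]
    simp only [Finset.sum_range_succ, Finset.sum_range_zero, bernoulli'_zero, bernoulli'_one, bernoulli'_two, h3, bernoulli'_four, h5, h6, h7, h8, h9, h10, h11, h12, h13]
    norm_num [Nat.choose]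
  have h16 : bernoulli' 16 = -3617/510 := by
    rw [bernoulli'_def]
    simp only [Finset.sum_range_succ, Finset.sum_range_zero, bernoulli'_zero, bernoulli'_one, bernoulli'_two, h3, bernoulli'_four, h5, h6, h7, h8, h9, h10, h11, h12, h13, h14, h15]
    norm_num [Nat.choose]
  have e : ∀ n, n ≠ 1 → bernoulli n = bernoulli' n := fun n h => bernoulli_eq_bernoulli'_of_ne_one h
  rw [e 2 (by norm_num), e 4 (by norm_num), e 6 (by norm_num), e 8 (by norm_num),
    e 10 (by norm_num), e 12 (by norm_num), e 14 (by norm_num), e 16 (by norm_num)]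
  exact ⟨bernoulli'_two, bernoulli'_four, h6, h8, h10, h12, h14, h16⟩

lemma absb_sum (n : ℕ) (hn : 8 ≤ n) : ∑ d ∈ Finset.Ico 1 n, absb d ≤ absb n := by
  induction n, hn using Nat.le_induction with
  | base =>
    obtain ⟨h2, h4, h6, h8, h10, h12, h14, h16⟩ := bern_vals
    simp only [absb]
    norm_num [h2, h4, h6, h8, h10, h12, h14, h16, Finset.sum_Ico_succ_top, abs_div, abs_of_pos, abs_of_neg]
  | succ n hn ih =>
    rw [Finset.sum_Ico_succ_top (by omega)]
    linarith [absb_growth n hn]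

lemma tau_vals : bernoulliTau 1 = 1 ∧ bernoulliTau 2 = 1 ∧ bernoulliTau 3 = 1 ∧
    bernoulliTau 4 = 1 ∧ bernoulliTau 5 = 1 ∧ bernoulliTau 6 = 691 ∧ bernoulliTau 7 = 1 := by
  obtain ⟨h2, h4, h6, h8, h10, h12, h14, h16⟩ := bern_vals
  have key : ∀ n : ℕ, ∀ q : ℚ, |bernoulli (2 * n) / (2 * n : ℚ)| = q →
      bernoulliTau n = q.num.natAbs := by
    rintro n q rfl; rfl
  refine ⟨?_, ?_, ?_, ?_, ?_, ?_, ?_⟩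
  · rw [key 1 (1 / 12) (by norm_num [h2, abs_of_pos])]; norm_num
  · rw [key 2 (1 / 120) (by norm_num [h4, abs_of_pos, abs_div])]; norm_num
  · rw [key 3 (1 / 252) (by norm_num [h6, abs_of_pos, abs_div])]; norm_num
  · rw [key 4 (1 / 240) (by norm_num [h8, abs_of_pos, abs_div])]; norm_num
  · rw [key 5 (1 / 132) (by norm_num [h10, abs_of_pos, abs_div])]; norm_num
  · rw [key 6 (691 / 32760) (by norm_num [h12, abs_of_pos, abs_div])]; norm_num
  · rw [key 7 (1 / 12) (by norm_num [h14, abs_of_pos, abs_div])]; norm_num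

lemma dold_small : ∀ n, 1 ≤ n → n < 8 → 0 ≤ doldSum bernoulliTau n := by
  obtain ⟨h1, h2, h3, h4, h5, h6, h7⟩ := tau_vals
  have hp : ∀ p : ℕ, p.Prime → doldSum bernoulliTau p = bernoulliTau p - bernoulliTau 1 := by
    intro p hp
    rw [doldSum, hp.sum_divisors, Nat.div_self hp.pos, Nat.div_one,
      ArithmeticFunction.moebius_apply_prime hp]
    simp; ring
  intro n hn hn8
  interval_cases n
  · simp [doldSum]
  · rw [hp 2 (by norm_num), h2, h1]; norm_num
  · rw [hp 3 (by norm_num), h3, h1]; norm_num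
  · have hd : Nat.divisors 4 = {1, 2, 4} := by decide
    have hm : ArithmeticFunction.moebius 4 = 0 := by
      rw [show 4 = 2 ^ 2 by norm_num, ArithmeticFunction.moebius_apply_prime_pow Nat.prime_two (by norm_num)]
      norm_num
    rw [doldSum, hd]
    simp [hm, h2, h4, ArithmeticFunction.moebius_apply_prime Nat.prime_two]
  · rw [hp 5 (by norm_num), h5, h1]; norm_num
  · have hd : Nat.divisors 6 = {1, 2, 3, 6} := by decide
    have hm : |ArithmeticFunction.moebius 6| ≤ 1 := ArithmeticFunction.abs_moebius_le_one
    have hm' := (abs_le.1 hm).1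
    rw [doldSum, hd]
    simp [h1, h2, h3, h6, ArithmeticFunction.moebius_apply_prime Nat.prime_two,
      ArithmeticFunction.moebius_apply_prime Nat.prime_three]
    linarith
  · rw [hp 7 (by norm_num), h7, h1]; norm_num

lemma dold_nonneg (β : ℕ → ℕ) (hβ : ∀ n, 1 ≤ n → (bernoulliTau n : ℚ) = absb n * β n)
    (hmono : ∀ d n, 1 ≤ n → d ∣ n → β d ≤ β n) :
    ∀ n, 1 ≤ n → 0 ≤ doldSum bernoulliTau n := by
  intro n hn
  rcases lt_or_ge n 8 with h8 | h8
  · exact dold_small n hn h8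
  have h1 : ∑ d ∈ n.properDivisors, (bernoulliTau d : ℚ) ≤ bernoulliTau n := by
    rw [hβ n hn]
    calc ∑ d ∈ n.properDivisors, (bernoulliTau d : ℚ)
        ≤ ∑ d ∈ n.properDivisors, absb d * β n := by
          refine Finset.sum_le_sum fun d hd => ?_
          have hd' := Nat.mem_properDivisors.1 hd
          have hd1 : 1 ≤ d := Nat.pos_of_dvd_of_pos hd'.1 hn
          rw [hβ d hd1]
          have := absb_pos d hd1
          have h3 : (β d : ℚ) ≤ β n := by exact_mod_cast hmono d n hn hd'.1
          gcongr
      _ ≤ ∑ d ∈ Finset.Ico 1 n, absb d * β n := by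
          refine Finset.sum_le_sum_of_subset_of_nonneg ?_ ?_
          · intro d hd
            have hd' := Nat.mem_properDivisors.1 hd
            have hd1 : 1 ≤ d := Nat.pos_of_dvd_of_pos hd'.1 hn
            simp; omega
          · intro d hd _
            have := absb_pos d (Finset.mem_Ico.1 hd).1
            positivity
      _ ≤ absb n * β n := by
          rw [← Finset.sum_mul]
          have := absb_sum n h8
          gcongr
  have h2 : ∑ d ∈ n.properDivisors, (bernoulliTau d : ℤ) ≤ bernoulliTau n := by exact_mod_cast h1
  rw [doldSum, ← Nat.cons_self_properDivisors (by omega), Finset.sum_cons,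
    Nat.div_self (by omega)]
  simp only [ArithmeticFunction.moebius_apply_one, one_mul]
  have h3 : ∑ d ∈ n.properDivisors, -(bernoulliTau d : ℤ) ≤
      ∑ d ∈ n.properDivisors, (ArithmeticFunction.moebius (n / d) : ℤ) * (bernoulliTau d : ℤ) := by
    refine Finset.sum_le_sum fun d _ => ?_
    have : |ArithmeticFunction.moebius (n / d)| ≤ 1 := ArithmeticFunction.abs_moebius_le_one
    have := (abs_le.1 this).1
    nlinarith [Int.natCast_nonneg (bernoulliTau d)]
  rw [Finset.sum_neg_distrib] at h3
  linarith

end Analytic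
section PAdic

/-- `x` has `p`-adic valuation at least `k`. -/
def PD (p : ℕ) (k : ℤ) (x : ℚ) : Prop := padicNorm p x ≤ (p : ℚ) ^ (-k)

variable {p : ℕ} [hp : Fact p.Prime]

lemma PD.p_pos : (0 : ℚ) < p := by exact_mod_cast hp.out.pos

lemma PD.one_le : (1 : ℚ) ≤ p := by exact_mod_cast hp.out.one_le

lemma PD.zpow_pos' (k : ℤ) : (0 : ℚ) < (p : ℚ) ^ k := zpow_pos PD.p_pos k

lemma PD.zero (k : ℤ) : PD p k 0 := by
  unfold PD; rw [padicNorm.zero]; exact (PD.zpow_pos' _).le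

lemma PD.add {k : ℤ} {x y : ℚ} (hx : PD p k x) (hy : PD p k y) : PD p k (x + y) :=
  padicNorm.nonarchimedean.trans (max_le hx hy)

lemma PD.neg {k : ℤ} {x : ℚ} (hx : PD p k x) : PD p k (-x) := by
  unfold PD; rw [padicNorm.neg]; exact hx

lemma PD.sub {k : ℤ} {x y : ℚ} (hx : PD p k x) (hy : PD p k y) : PD p k (x - y) := by
  rw [sub_eq_add_neg]; exact hx.add hy.neg

lemma PD.mul {k l : ℤ} {x y : ℚ} (hx : PD p k x) (hy : PD p l y) : PD p (k + l) (x * y) := by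
  unfold PD at *
  rw [padicNorm.mul, neg_add, zpow_add₀ PD.p_pos.ne']
  exact mul_le_mul hx hy (padicNorm.nonneg _) (PD.zpow_pos' _).le

lemma PD.mono {k l : ℤ} {x : ℚ} (hx : PD p k x) (h : l ≤ k) : PD p l x := by
  unfold PD at *
  exact hx.trans (zpow_le_zpow_right₀ PD.one_le (by omega))

lemma PD.sum {ι : Type*} {s : Finset ι} {f : ι → ℚ} {k : ℤ} (h : ∀ i ∈ s, PD p k (f i)) :
    PD p k (∑ i ∈ s, f i) :=
  padicNorm.sum_le' h (PD.zpow_pos' _).le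

lemma PD.int (z : ℤ) : PD p 0 (z : ℚ) := by
  unfold PD; simpa using padicNorm.of_int z

lemma PD.nat (z : ℕ) : PD p 0 (z : ℚ) := by
  unfold PD; simpa using padicNorm.of_nat z

lemma PD.int_iff (k : ℕ) (z : ℤ) : PD p k (z : ℚ) ↔ (p : ℤ) ^ k ∣ z := by
  unfold PD; rw [← padicNorm.dvd_iff_norm_le]; push_cast; rfl

lemma PD.mul_unit {k : ℤ} {x y : ℚ} (hx : padicNorm p x = 1) (h : PD p k (x * y)) : PD p k y := by
  unfold PD at *
  rwa [padicNorm.mul, hx, one_mul] at h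

lemma PD.p_zpow (k : ℤ) : PD p k ((p : ℚ) ^ k) := by
  unfold PD
  have : padicNorm p ((p : ℚ) ^ k) = (p : ℚ) ^ (-k) := by
    rw [padicNorm.eq_zpow_of_nonzero (PD.zpow_pos' k).ne', padicValRat.zpow,
      padicValRat.self hp.out.one_lt, mul_one]
  exact this.le

lemma PD.p_pow (k : ℕ) : PD p k ((p : ℚ) ^ k) := by
  have := PD.p_zpow (p := p) k
  simpa using this

lemma PD.inv_nat {m w : ℕ} (hm : 0 < m) (h : m < p ^ (w + 1)) : PD p (-w) (1 / (m : ℚ)) := by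
  unfold PD
  have hm' : (m : ℚ) ≠ 0 := by positivity
  rw [padicNorm.div, padicNorm.one, padicNorm.eq_zpow_of_nonzero hm', one_div, ← zpow_neg, neg_neg,
    neg_neg]
  refine zpow_le_zpow_right₀ PD.one_le ?_
  rw [padicValRat.of_nat]
  have : padicValNat p m ≤ w := by
    by_contra hc
    push Not at hc
    have : p ^ (w + 1) ∣ m := (pow_dvd_pow p hc).trans pow_padicValNat_dvd
    exact absurd (Nat.le_of_dvd hm this) (by omega)
  exact_mod_cast this

/-- `p B_j` is `p`-integral. -/
lemma PD.bernoulli (j : ℕ) : PD p (-1) (bernoulli j) := by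
  have hinv : ∀ q : ℕ, q.Prime → PD p (-1) (1 / (q : ℚ)) := by
    intro q hq
    have : Fact q.Prime := ⟨hq⟩
    unfold PD
    rw [padicNorm.div, padicNorm.one]
    rcases eq_or_ne p q with rfl | hne
    · rw [padicNorm.padicNorm_p_of_prime]; simp
    · rw [padicNorm.padicNorm_of_prime_of_ne hne]; simpa using PD.one_le
  rcases Nat.even_or_odd j with he | ho
  · obtain ⟨k, rfl⟩ := he
    rw [← two_mul]
    obtain ⟨z, hz⟩ := Bernoulli.vonStaudt_clausen k
    rw [eq_sub_of_add_eq hz.symm]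
    refine ((PD.int z).mono (by norm_num)).sub (PD.sum ?_)
    intro q hq
    exact hinv q (Finset.mem_filter.1 hq).2.1
  · rcases eq_or_ne j 1 with rfl | h1
    · rw [bernoulli_one, neg_div]
      exact (hinv 2 Nat.prime_two).neg
    · rw [bernoulli_eq_zero_of_odd ho (by rcases ho with ⟨t, rfl⟩; omega)]
      exact PD.zero _

/-- The Faulhaber formula, rearranged. -/
lemma faulhaber (n M : ℕ) :
    (∑ j ∈ Finset.range M, (j : ℚ) ^ (n + 1)) = M * bernoulli (n + 1) +
      (n + 1) * ∑ i ∈ Finset.range (n + 1), (n.choose i : ℚ) * bernoulli (n - i) *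
        ((M : ℚ) ^ (i + 2) * (1 / ((i + 1 : ℕ) : ℚ) - 1 / ((i + 2 : ℕ) : ℚ))) := by
  rw [sum_range_pow, ← Finset.sum_range_reflect, Finset.sum_range_succ', add_comm, Finset.mul_sum]
  congr 1
  · have : n + 1 + 1 - 1 - 0 = n + 1 := by omega
    rw [this, show n + 1 + 1 - (n + 1) = 1 by omega, Nat.choose_succ_self_right]
    push_cast
    field_simp
  · refine Finset.sum_congr rfl fun i hi => ?_
    have hi' : i ≤ n := by simpa [Nat.lt_succ_iff] using hi
    rw [show n + 1 + 1 - 1 - (i + 1) = n - i by omega, show n + 1 + 1 - (n - i) = i + 2 by omega]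
    have e1 : (n + 1 + 1).choose (n - i) = (n + 2).choose (i + 2) := by
      rw [← Nat.choose_symm_of_eq_add]; omega
    have e2 : ((n + 2).choose (i + 2) : ℚ) * (i + 2) = (n + 2) * (n + 1).choose (i + 1) := by
      have := Nat.add_one_mul_choose_eq (n + 1) (i + 1)
      have h2 : (((n + 1 + 1) * (n + 1).choose (i + 1) : ℕ) : ℚ) =
        (((n + 1 + 1).choose (i + 1 + 1) * (i + 1 + 1) : ℕ) : ℚ) := by exact_mod_cast this
      push_cast at h2
      linarith
    have e3 : ((n + 1).choose (i + 1) : ℚ) * (i + 1) = (n + 1) * n.choose i := by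
      have := Nat.add_one_mul_choose_eq n i
      have h2 : (((n + 1) * n.choose i : ℕ) : ℚ) =
        (((n + 1).choose (i + 1) * (i + 1) : ℕ) : ℚ) := by exact_mod_cast this
      push_cast at h2
      linarith
    have e4 : ((n + 2).choose (i + 2) : ℚ) = (n + 2) * ((n + 1) * n.choose i) / ((i + 1) * (i + 2)) := by
      rw [← e3]
      field_simp
      linarith
    rw [e1, e4]
    push_cast
    field_simp
    ring

/-- Congruence for `p B_N` when `p - 1 ∣ N`. -/
lemma caseB {N k : ℕ} (hN : 1 ≤ N) (hk : 1 ≤ k) (h1 : p - 1 ∣ N) (h2 : p ^ (k - 1) ∣ N)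
    (h3 : p = 2 → 2 ^ k ∣ N) : PD p k (p * bernoulli N - (p - 1)) := by
  obtain ⟨n, rfl⟩ : ∃ n, N = n + 1 := ⟨N - 1, by omega⟩
  have hS := faulhaber n p
  have hpow : PD p k ((∑ j ∈ Finset.range p, (j : ℚ) ^ (n + 1)) - (p - 1)) := by
    obtain ⟨q, hq⟩ : ∃ q, p = q + 1 := ⟨p - 1, by have := hp.out.pos; omega⟩
    have : (∑ j ∈ Finset.range p, (j : ℚ) ^ (n + 1)) - (p - 1) =
        ∑ j ∈ Finset.range q, (((j + 1 : ℤ) ^ (n + 1) - 1 : ℤ) : ℚ) := by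
      rw [hq, Finset.sum_range_succ']
      push_cast
      simp
    rw [this]
    refine PD.sum fun j hj => ?_
    rw [PD.int_iff]
    have hj' : j < q := by simpa using hj
    have hcop : Nat.Coprime (j + 1) (p ^ k) := by
      refine Nat.Coprime.pow_right _ (Nat.Coprime.symm ?_)
      rw [Nat.Prime.coprime_iff_not_dvd hp.out]
      intro hd
      have := Nat.le_of_dvd (by omega) hd
      omega
    have htot : (p ^ k).totient ∣ n + 1 := by
      rw [Nat.totient_prime_pow hp.out (by omega)]
      refine Nat.Coprime.mul_dvd_of_dvd_of_dvd ?_ h2 h1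
      refine Nat.Coprime.pow_left _ ?_
      rw [Nat.Prime.coprime_iff_not_dvd hp.out]
      intro hd
      have h5 := hp.out.two_le
      have := Nat.le_of_dvd (by omega) hd
      omega
    obtain ⟨c, hc⟩ := htot
    have h6 : (j + 1) ^ (n + 1) ≡ 1 [MOD p ^ k] := by
      rw [hc, pow_mul]
      simpa using (Nat.ModEq.pow_totient hcop).pow c
    have := (Nat.modEq_iff_dvd.1 h6.symm)
    push_cast at this
    exact this
  have hrest : PD p k (((n : ℚ) + 1) * ∑ i ∈ Finset.range (n + 1), (n.choose i : ℚ) * bernoulli (n - i) *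
        ((p : ℚ) ^ (i + 2) * (1 / ((i + 1 : ℕ) : ℚ) - 1 / ((i + 2 : ℕ) : ℚ)))) := by
    rcases eq_or_ne p 2 with h | h
    · have hN' : PD p k ((n : ℚ) + 1) := by
        have : PD p k ((n + 1 : ℤ) : ℚ) := by
          rw [PD.int_iff]
          have := h3 h
          rw [h]
          exact_mod_cast this
        exact_mod_cast this
      rw [show (k : ℤ) = k + 0 by ring]
      refine hN'.mul (PD.sum fun i _ => ?_)
      have hb : ∀ m, 0 < m → m ≤ i + 2 → PD p (-(i + 1 : ℕ)) (1 / (m : ℚ)) := by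
        intro m hm hmi
        refine PD.inv_nat hm (lt_of_le_of_lt hmi ?_)
        rw [h]; exact Nat.lt_two_pow_self
      have := (((PD.nat (p := p) (n.choose i)).mul (PD.bernoulli (n - i))).mul
        ((PD.p_pow (i + 2)).mul ((hb (i + 1) (by omega) (by omega)).sub
          (hb (i + 2) (by omega) (by omega)))))
      exact this.mono (by push_cast; omega)
    · have hp3 : 3 ≤ p := by have := hp.out.two_le; omega
      have hN' : PD p (k - 1 : ℕ) ((n : ℚ) + 1) := by
        have : PD p (k - 1 : ℕ) ((n + 1 : ℤ) : ℚ) := by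
          rw [PD.int_iff]
          exact_mod_cast h2
        exact_mod_cast this
      rw [show (k : ℤ) = (k - 1 : ℕ) + 1 by omega]
      refine hN'.mul (PD.sum fun i _ => ?_)
      have hb : ∀ m, 0 < m → m ≤ i + 2 → PD p (-(i : ℕ)) (1 / (m : ℚ)) := by
        intro m hm hmi
        refine PD.inv_nat hm (lt_of_le_of_lt hmi ?_)
        have h7 : ∀ i : ℕ, i + 2 < 3 ^ (i + 1) := by
          intro i
          induction i with
          | zero => norm_num
          | succ i ih => rw [pow_succ]; omega
        exact (h7 i).trans_le (Nat.pow_le_pow_left hp3 _)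
      have := (((PD.nat (p := p) (n.choose i)).mul (PD.bernoulli (n - i))).mul
        ((PD.p_pow (i + 2)).mul ((hb (i + 1) (by omega) (by omega)).sub
          (hb (i + 2) (by omega) (by omega)))))
      exact this.mono (by push_cast; omega)
  have := hpow.sub hrest
  rw [hS] at this
  convert this using 1
  ring


lemma binom_expand (n r : ℕ) (hr : 1 ≤ r) (x q : ℤ) :
    PD p (2 * r - 1) (((((x - p ^ r * q) ^ (n + 1) - x ^ (n + 1) : ℤ)) : ℚ) / (n + 1) +
      (((x ^ n * (p ^ r * q) : ℤ)) : ℚ)) := by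
  set y : ℚ := -((p : ℚ) ^ r * q) with hy
  have e : ((((x - p ^ r * q) ^ (n + 1) - x ^ (n + 1) : ℤ)) : ℚ) / (n + 1) +
      (((x ^ n * (p ^ r * q) : ℤ)) : ℚ) = ∑ t ∈ Finset.range n,
        ((n.choose (t + 1) * x ^ (n - (t + 1)) * (-q) ^ (t + 2) : ℤ) : ℚ) *
          (((p : ℚ) ^ (r * (t + 2))) * (1 / ((t + 2 : ℕ) : ℚ))) := by
    have h1 : (((x - p ^ r * q) ^ (n + 1) - x ^ (n + 1) : ℤ) : ℚ) = (y + x) ^ (n + 1) - x ^ (n + 1) := by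
      rw [hy]; push_cast; ring
    rw [h1, add_pow, Finset.sum_range_succ', Finset.sum_range_succ']
    have h2 : ∀ t ∈ Finset.range n, y ^ (t + 1 + 1) * (x : ℚ) ^ (n + 1 - (t + 1 + 1)) *
        ((n + 1).choose (t + 1 + 1) : ℚ) = (n + 1) * (((n.choose (t + 1) * x ^ (n - (t + 1)) * (-q) ^ (t + 2) : ℤ) : ℚ) *
          (((p : ℚ) ^ (r * (t + 2))) * (1 / ((t + 2 : ℕ) : ℚ)))) := by
      intro t _
      have e3 : ((n + 1).choose (t + 1 + 1) : ℚ) = (n + 1) * n.choose (t + 1) / (t + 2) := by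
        have := Nat.add_one_mul_choose_eq n (t + 1)
        have h2 : (((n + 1) * n.choose (t + 1) : ℕ) : ℚ) =
          (((n + 1).choose (t + 1 + 1) * (t + 1 + 1) : ℕ) : ℚ) := by exact_mod_cast this
        push_cast at h2
        field_simp
        linarith
      rw [e3, hy, show n + 1 - (t + 1 + 1) = n - (t + 1) by omega, pow_mul]
      push_cast
      rw [show -((p : ℚ) ^ r * q) = p ^ r * (-q) by ring, mul_pow]
      ring
    rw [Finset.sum_congr rfl h2, ← Finset.mul_sum]
    have hn : (n : ℚ) + 1 ≠ 0 := by positivity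
    simp only [zero_add, pow_zero, pow_one, Nat.choose_zero_right, Nat.choose_one_right,
      Nat.add_sub_cancel, Nat.sub_zero]
    rw [hy]
    push_cast
    field_simp
    ring
  rw [e]
  refine PD.sum fun t _ => ?_
  have hb : PD p (-(t + 1 : ℕ)) (1 / ((t + 2 : ℕ) : ℚ)) := by
    refine PD.inv_nat (by omega) ?_
    exact Nat.lt_two_pow_self.trans_le (Nat.pow_le_pow_left hp.out.two_le _)
  have := (PD.int (p := p) (n.choose (t + 1) * x ^ (n - (t + 1)) * (-q) ^ (t + 2))).mul
    ((PD.p_pow (r * (t + 2))).mul hb)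
  refine this.mono ?_
  push_cast
  have : (1 : ℤ) ≤ r := by exact_mod_cast hr
  nlinarith [mul_nonneg (Int.natCast_nonneg t) (sub_nonneg.2 this)]

/-- Permutation of residues by multiplication. -/
lemma sum_perm (a M : ℕ) (hM : 0 < M) (h : Nat.Coprime a M) (f : ℕ → ℚ) :
    ∑ j ∈ Finset.range M, f (j * a % M) = ∑ j ∈ Finset.range M, f j := by
  have hinj : Set.InjOn (fun j => j * a % M) (Finset.range M : Set ℕ) := by
    intro i hi j hj hij
    simp only [Finset.coe_range, Set.mem_Iio] at hi hj
    have h1 : i * a ≡ j * a [MOD M] := hij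
    have h2 := Nat.ModEq.cancel_right_of_coprime (Nat.Coprime.symm h) h1
    exact Nat.ModEq.eq_of_lt_of_lt h2 hi hj
  have himg : (Finset.range M).image (fun j => j * a % M) = Finset.range M := by
    refine Finset.eq_of_subset_of_card_le ?_ ?_
    · intro x hx
      obtain ⟨j, _, rfl⟩ := Finset.mem_image.1 hx
      exact Finset.mem_range.2 (Nat.mod_lt _ hM)
    · rw [Finset.card_image_of_injOn hinj]
  conv_rhs => rw [← himg]
  rw [Finset.sum_image hinj]

/-- The Voronoi congruence. -/
lemma voronoi (a n r : ℕ) (hr : 1 ≤ r) (ha : ¬ p ∣ a) :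
    PD p (r - 2) (((a : ℚ) ^ (n + 1) - 1) * (bernoulli (n + 1) / (n + 1)) -
      ((∑ j ∈ Finset.range (p ^ r), ((j * a : ℕ) : ℤ) ^ n * ((j * a / p ^ r : ℕ) : ℤ) : ℤ) : ℚ)) := by
  set M := p ^ r with hM
  have hMpos : 0 < M := pow_pos hp.out.pos _
  have hMq : (M : ℚ) = (p : ℚ) ^ r := by rw [hM]; push_cast; rfl
  have hcop : Nat.Coprime a M :=
    Nat.Coprime.pow_right _ (Nat.Coprime.symm ((Nat.Prime.coprime_iff_not_dvd hp.out).2 ha))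
  set S := ∑ j ∈ Finset.range M, (j : ℚ) ^ (n + 1) with hS
  have hn : (n : ℚ) + 1 ≠ 0 := by positivity
  have hMne : (M : ℚ) ≠ 0 := by positivity
  set V : ℚ := ((∑ j ∈ Finset.range M, ((j * a : ℕ) : ℤ) ^ n * ((j * a / M : ℕ) : ℤ) : ℤ) : ℚ) with hV
  have h1 : PD p (2 * r - 1) ((S - a ^ (n + 1) * S) / (n + 1) + M * V) := by
    have : (S - a ^ (n + 1) * S) / (n + 1) + M * V = ∑ j ∈ Finset.range M,
        ((((((j * a : ℕ) : ℤ) - p ^ r * ((j * a / M : ℕ) : ℤ)) ^ (n + 1) -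
          ((j * a : ℕ) : ℤ) ^ (n + 1) : ℤ)) / ((n : ℚ) + 1) +
          (((((j * a : ℕ) : ℤ) ^ n * (p ^ r * ((j * a / M : ℕ) : ℤ)) : ℤ)) : ℚ)) := by
      rw [Finset.sum_add_distrib, ← Finset.sum_div]
      congr 1
      · congr 1
        push_cast
        rw [Finset.sum_sub_distrib]
        congr 1
        · rw [hS, ← sum_perm a M hMpos hcop (fun j => (j : ℚ) ^ (n + 1))]
          refine Finset.sum_congr rfl fun j _ => ?_
          have := Nat.mod_add_div (j * a) M
          have h3 : ((j * a % M : ℕ) : ℚ) + M * ((j * a / M : ℕ) : ℚ) = (j : ℚ) * a := by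
            exact_mod_cast this
          have h4 : (((j : ℤ) * a / M : ℤ) : ℚ) = ((j * a / M : ℕ) : ℚ) := by
            rw [← Int.cast_natCast (j * a / M)]
            push_cast
            rfl
          rw [← hMq, h4, ← h3]
          ring
        · rw [hS, Finset.mul_sum]
          refine Finset.sum_congr rfl fun j _ => ?_
          ring
      · rw [hV, hMq]
        push_cast
        rw [Finset.mul_sum]
        refine Finset.sum_congr rfl fun j _ => ?_
        ring
    rw [this]
    exact PD.sum fun j _ => binom_expand n r hr _ _
  have h2 : PD p (2 * r - 2) (S / (n + 1) - M * (bernoulli (n + 1) / (n + 1))) := by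
    have : S / (n + 1) - M * (bernoulli (n + 1) / (n + 1)) =
       ∑ i ∈ Finset.range (n + 1), (n.choose i : ℚ) * bernoulli (n - i) *
        ((M : ℚ) ^ (i + 2) * (1 / ((i + 1 : ℕ) : ℚ) - 1 / ((i + 2 : ℕ) : ℚ))) := by
      rw [hS, faulhaber n M]
      field_simp
      ring
    rw [this]
    refine PD.sum fun i _ => ?_
    have hb : ∀ m, 0 < m → m ≤ i + 2 → PD p (-(i + 1 : ℕ)) (1 / (m : ℚ)) := by
      intro m hm hmi
      refine PD.inv_nat hm (lt_of_le_of_lt hmi ?_)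
      exact Nat.lt_two_pow_self.trans_le (Nat.pow_le_pow_left hp.out.two_le _)
    rw [hMq, ← pow_mul]
    have := (((PD.nat (p := p) (n.choose i)).mul (PD.bernoulli (n - i))).mul
      ((PD.p_pow (r * (i + 2))).mul ((hb (i + 1) (by omega) (by omega)).sub
        (hb (i + 2) (by omega) (by omega)))))
    refine this.mono ?_
    push_cast
    have : (1 : ℤ) ≤ r := by exact_mod_cast hr
    nlinarith [mul_nonneg (Int.natCast_nonneg i) (sub_nonneg.2 this)]
  have h3 : PD p 0 ((a : ℚ) ^ (n + 1) - 1) := by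
    have := PD.int (p := p) ((a : ℤ) ^ (n + 1) - 1)
    push_cast at this
    exact this
  have h4 := (h1.mono (by omega : (2 * (r : ℤ) - 2) ≤ 2 * r - 1)).neg.sub
    ((h3.mul h2).mono (by omega : (2 * (r : ℤ) - 2) ≤ 0 + (2 * r - 2)))
  have h5 := (PD.p_zpow (p := p) (-(r : ℤ))).mul h4
  rw [show (-(r : ℤ)) + (2 * r - 2) = r - 2 by ring] at h5
  convert h5 using 1
  rw [zpow_neg, zpow_natCast, ← hMq]
  field_simp
  ring

/-- The Kummer congruence in the form we need. -/
lemma kummer {n n' k : ℕ} (hpow : ∀ x : ℤ, (p : ℤ) ^ k ∣ x ^ n - x ^ n') (hk : 1 ≤ k)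
    (hnd : ¬ (p - 1) ∣ n + 1) :
    PD p k (bernoulli (n + 1) / (n + 1) - bernoulli (n' + 1) / (n' + 1)) ∧
      PD p 0 (bernoulli (n + 1) / (n + 1)) ∧ PD p 0 (bernoulli (n' + 1) / (n' + 1)) := by
  obtain ⟨g, hg⟩ := IsCyclic.exists_generator (α := (ZMod p)ˣ)
  set a : ℕ := (g : ZMod p).val with ha
  have hag : (a : ZMod p) = g := by rw [ha]; exact ZMod.natCast_zmod_val _
  have hpa : ¬ p ∣ a := by
    rw [← ZMod.natCast_eq_zero_iff, hag]
    exact g.ne_zero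
  have hord : orderOf g = p - 1 := by
    rw [orderOf_eq_card_of_forall_mem_zpowers hg, Nat.card_eq_fintype_card, ZMod.card_units]
  have hu : padicNorm p ((a : ℚ) ^ (n + 1) - 1) = 1 := by
    have : padicNorm p (((a : ℤ) ^ (n + 1) - 1 : ℤ) : ℚ) = 1 := by
      rw [padicNorm.int_eq_one_iff]
      rw [← ZMod.intCast_zmod_eq_zero_iff_dvd]
      push_cast
      rw [hag, sub_eq_zero]
      intro h
      apply hnd
      rw [← hord, orderOf_dvd_iff_pow_eq_one]
      ext
      simpa using h
    push_cast at this
    exact this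
  have hdiff : PD p k (((a : ℚ) ^ (n + 1) - 1) - ((a : ℚ) ^ (n' + 1) - 1)) := by
    have : PD p k (((a : ℤ) ^ (n + 1) - (a : ℤ) ^ (n' + 1) : ℤ) : ℚ) := by
      rw [PD.int_iff]
      have := (hpow a).mul_right (a : ℤ)
      have e : (a : ℤ) ^ (n + 1) - (a : ℤ) ^ (n' + 1) = ((a : ℤ) ^ n - (a : ℤ) ^ n') * a := by ring
      rw [e]
      exact this
    push_cast at this
    convert this using 1
    ring
  have hu' : padicNorm p ((a : ℚ) ^ (n' + 1) - 1) = 1 := by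
    have h : padicNorm p (((a : ℤ) ^ (n' + 1) - 1 : ℤ) : ℚ) = 1 := by
      rw [padicNorm.int_eq_one_iff]
      intro h
      have h2 : (p : ℤ) ∣ (a : ℤ) ^ (n + 1) - 1 := by
        have h3 := ((dvd_pow_self (p : ℤ) (by omega : k ≠ 0)).trans (hpow a)).mul_right (a : ℤ)
        have := dvd_add h3 h
        have e : (a : ℤ) ^ (n + 1) - 1 = ((a : ℤ) ^ n - (a : ℤ) ^ n') * a + ((a : ℤ) ^ (n' + 1) - 1) := by ring
        rw [e]
        exact this
      rw [← padicNorm.int_lt_one_iff] at h2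
      push_cast at h2
      linarith
    push_cast at h
    exact h
  set r := k + 2 with hr
  have v := voronoi (p := p) a n r (by omega) hpa
  have v' := voronoi (p := p) a n' r (by omega) hpa
  rw [show ((r : ℕ) : ℤ) - 2 = k by rw [hr]; push_cast; ring] at v v'
  have hint : ∀ m, PD p k (((a : ℚ) ^ (m + 1) - 1) * (bernoulli (m + 1) / (m + 1)) -
      ((∑ j ∈ Finset.range (p ^ r), ((j * a : ℕ) : ℤ) ^ m * ((j * a / p ^ r : ℕ) : ℤ) : ℤ) : ℚ)) →
      PD p 0 (((a : ℚ) ^ (m + 1) - 1) * (bernoulli (m + 1) / (m + 1))) := by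
    intro m hm
    have := (hm.mono (by omega : (0 : ℤ) ≤ k)).add (PD.int
      (∑ j ∈ Finset.range (p ^ r), ((j * a : ℕ) : ℤ) ^ m * ((j * a / p ^ r : ℕ) : ℤ)))
    rwa [sub_add_cancel] at this
  have i := (hint n v).mul_unit hu
  have i' := (hint n' v').mul_unit hu'
  refine ⟨?_, i, i'⟩
  have hV : PD p k (((∑ j ∈ Finset.range (p ^ r), ((j * a : ℕ) : ℤ) ^ n * ((j * a / p ^ r : ℕ) : ℤ) : ℤ) : ℚ)
      - ((∑ j ∈ Finset.range (p ^ r), ((j * a : ℕ) : ℤ) ^ n' * ((j * a / p ^ r : ℕ) : ℤ) : ℤ) : ℚ)) := by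
    rw [← Int.cast_sub, PD.int_iff, ← Finset.sum_sub_distrib]
    refine Finset.dvd_sum fun j _ => ?_
    rw [← sub_mul]
    exact (hpow _).mul_right _
  have h6 := ((v.sub v').add hV).sub ((hdiff.mul i').mono (by omega : (k : ℤ) ≤ k + 0))
  refine PD.mul_unit hu ?_
  convert h6 using 1
  ring

/-- The primes `q` with `q - 1 ∣ 2n`. -/
def primeSet (n : ℕ) : Finset ℕ := {q ∈ Finset.range (2 * n + 2) | q.Prime ∧ q - 1 ∣ 2 * n}

lemma mem_primeSet {n q : ℕ} (hn : 1 ≤ n) : q ∈ primeSet n ↔ q.Prime ∧ q - 1 ∣ 2 * n := by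
  simp only [primeSet, Finset.mem_filter, Finset.mem_range, and_iff_right_iff_imp]
  rintro ⟨_, h⟩
  have := Nat.le_of_dvd (by omega) h
  omega

/-- The explicit denominator. -/
def bet (n : ℕ) : ℕ := ∏ q ∈ primeSet n, q ^ (1 + padicValNat q (2 * n))

lemma bet_pos (n : ℕ) : 0 < bet n :=
  Finset.prod_pos fun q hq => pow_pos (Finset.mem_filter.1 hq).2.1.pos _

lemma bet_mono (d n : ℕ) (hn : 1 ≤ n) (hd : d ∣ n) : bet d ≤ bet n := by
  have hd1 : 1 ≤ d := Nat.pos_of_dvd_of_pos hd hn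
  refine Nat.le_of_dvd (bet_pos n) ?_
  have hsub : primeSet d ⊆ primeSet n := by
    intro q hq
    rw [mem_primeSet hd1] at hq
    rw [mem_primeSet hn]
    exact ⟨hq.1, hq.2.trans (mul_dvd_mul_left 2 hd)⟩
  refine dvd_trans ?_ (Finset.prod_dvd_prod_of_subset _ _ _ hsub)
  refine Finset.prod_dvd_prod_of_dvd _ _ fun q hq => ?_
  have hq' := (mem_primeSet hd1).1 hq
  have : Fact q.Prime := ⟨hq'.1⟩
  refine pow_dvd_pow q (Nat.add_le_add_left ?_ 1)
  exact (padicValNat_dvd_iff_le (by omega)).1 (pow_padicValNat_dvd.trans (mul_dvd_mul_left 2 hd))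

lemma norm_nat_pow_val (m : ℕ) (hm : m ≠ 0) : padicNorm p ((p : ℚ) ^ (padicValNat p m) / m) = 1 := by
  have hm' : (m : ℚ) ≠ 0 := by exact_mod_cast hm
  rw [padicNorm.div, padicNorm.eq_zpow_of_nonzero hm', padicNorm.eq_zpow_of_nonzero
    (pow_ne_zero _ PD.p_pos.ne'), padicValRat.of_nat, padicValRat.pow,
    padicValRat.self hp.out.one_lt, mul_one]
  exact div_self (PD.zpow_pos' _).ne'

def betR (p n : ℕ) : ℕ := ∏ q ∈ (primeSet n).erase p, q ^ (1 + padicValNat q (2 * n))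

lemma bet_eq_A {n : ℕ} (h : ¬ (p - 1) ∣ 2 * n) : bet n = betR p n := by
  have : p ∉ primeSet n := fun hm => h (Finset.mem_filter.1 hm).2.2
  rw [bet, betR, Finset.erase_eq_of_notMem this]

lemma bet_eq_B {n : ℕ} (hn : 1 ≤ n) (h : (p - 1) ∣ 2 * n) :
    bet n = p ^ (1 + padicValNat p (2 * n)) * betR p n := by
  have : p ∈ primeSet n := (mem_primeSet hn).2 ⟨hp.out, h⟩
  rw [bet, betR, Finset.mul_prod_erase (primeSet n) (fun q => q ^ (1 + padicValNat q (2 * n))) this]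

lemma betR_not_dvd (n : ℕ) : ¬ p ∣ betR p n := by
  rw [betR, Prime.dvd_finset_prod_iff hp.out.prime]
  rintro ⟨q, hq, hd⟩
  have hq' := Finset.mem_erase.1 hq
  have := (Nat.prime_dvd_prime_iff_eq hp.out (Finset.mem_filter.1 hq'.2).2.1).1
    (hp.out.dvd_of_dvd_pow hd)
  exact hq'.1 this.symm

lemma b_integral {n : ℕ} (hn : 1 ≤ n) (h : ¬ (p - 1) ∣ 2 * n) :
    PD p 0 (bernoulli (2 * n) / (2 * n : ℚ)) := by
  have := (kummer (p := p) (n := 2 * n - 1) (n' := 2 * n - 1) (k := 1) (fun x => by simp) le_rfl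
    (by rwa [show 2 * n - 1 + 1 = 2 * n by omega])).2.1
  have e : ((2 * n - 1 : ℕ) : ℚ) + 1 = 2 * n := by
    have : 2 * n - 1 + 1 = 2 * n := by omega
    exact_mod_cast this
  rwa [show 2 * n - 1 + 1 = 2 * n by omega, e] at this

lemma norm_pB {n : ℕ} (hn : 1 ≤ n) (h : (p - 1) ∣ 2 * n) :
    padicNorm p (p * bernoulli (2 * n)) = 1 := by
  have hB := caseB (p := p) (N := 2 * n) (k := 1) (by omega) le_rfl h (by simp)
    (fun h => by simp)
  have hB2 : PD p 1 (p * bernoulli (2 * n) + 1) := by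
    have := hB.add (by simpa using PD.p_pow (p := p) 1 : PD p (1 : ℕ) (p : ℚ))
    have e : (p : ℚ) * bernoulli (2 * n) + 1 = p * bernoulli (2 * n) - (p - 1) + p := by ring
    rw [e]
    exact this
  have hlt : padicNorm p (p * bernoulli (2 * n) + 1) < 1 := by
    refine lt_of_le_of_lt hB2 ?_
    rw [zpow_neg, zpow_one]
    exact inv_lt_one_of_one_lt₀ (by exact_mod_cast hp.out.one_lt)
  have h1 : padicNorm p (-1 : ℚ) = 1 := by rw [padicNorm.neg, padicNorm.one]
  have e : (p : ℚ) * bernoulli (2 * n) = (p * bernoulli (2 * n) + 1) + (-1) := by ring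
  rw [e, padicNorm.add_eq_max_of_ne (by rw [h1]; exact hlt.ne), h1]
  exact max_eq_right hlt.le

lemma norm_bet_mul {n : ℕ} (hn : 1 ≤ n) (h : (p - 1) ∣ 2 * n) :
    padicNorm p (absb n * bet n) = 1 := by
  have hb : padicNorm p (absb n) = padicNorm p (bernoulli (2 * n) / (2 * n : ℚ)) := by
    rw [absb]
    rcases abs_choice (bernoulli (2 * n) / (2 * n : ℚ)) with h | h
    · rw [h]
    · rw [h, padicNorm.neg]
  rw [padicNorm.mul, hb, ← padicNorm.mul, bet_eq_B hn h]
  have hne : (n : ℚ) ≠ 0 := by positivity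
  have e : bernoulli (2 * n) / (2 * n : ℚ) * ((p ^ (1 + padicValNat p (2 * n)) * betR p n : ℕ) : ℚ)
      = (p * bernoulli (2 * n)) * ((p : ℚ) ^ (padicValNat p (2 * n)) / (2 * n : ℕ)) * betR p n := by
    push_cast
    field_simp
    ring
  rw [e, padicNorm.mul, padicNorm.mul, norm_pB hn h, norm_nat_pow_val _ (by omega),
    (padicNorm.nat_eq_one_iff _).2 (betR_not_dvd n)]
  norm_num

end PAdic

section Final

lemma den_one_of_norm (x : ℚ) (h : ∀ p : ℕ, p.Prime → padicNorm p x ≤ 1) : x.den = 1 := by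
  by_contra hd
  obtain ⟨p, hp, hpd⟩ := Nat.exists_prime_and_dvd hd
  have : Fact p.Prime := ⟨hp⟩
  have h1 : padicNorm p (x.den : ℚ) < 1 := (padicNorm.nat_lt_one_iff _).2 hpd
  have h2 : padicNorm p (x.num : ℚ) = 1 := by
    rw [padicNorm.int_eq_one_iff]
    intro hn
    have h3 : p ∣ x.num.natAbs := Int.natCast_dvd.1 hn
    have := Nat.dvd_gcd h3 hpd
    rw [x.reduced] at this
    exact hp.one_lt.ne' (Nat.dvd_one.1 this)
  have h3 : x * x.den = x.num := Rat.mul_den_eq_num x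
  have h4 : padicNorm p x * padicNorm p x.den = 1 := by rw [← padicNorm.mul, h3, h2]
  have := h p hp
  have h5 := padicNorm.nonneg (p := p) x
  have h6 := padicNorm.nonneg (p := p) (x.den : ℚ)
  nlinarith

lemma tau_eq (n : ℕ) (hn : 1 ≤ n) : (bernoulliTau n : ℚ) = absb n * bet n := by
  have hbpos : 0 < absb n := absb_pos n hn
  have hint : (absb n * bet n).den = 1 := by
    refine den_one_of_norm _ fun p hp => ?_
    have : Fact p.Prime := ⟨hp⟩
    by_cases h : (p - 1) ∣ 2 * n
    · exact (norm_bet_mul hn h).le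
    · have h1 := b_integral hn h
      have h2 : PD p 0 (absb n) := by
        rw [absb]
        rcases abs_choice (bernoulli (2 * n) / (2 * n : ℚ)) with h | h
        · rwa [h]
        · rw [h]; exact h1.neg
      have := h2.mul (PD.nat (p := p) (bet n))
      simpa [PD] using this
  set c : ℤ := (absb n * bet n).num with hc
  have hcq : (c : ℚ) = absb n * bet n := Rat.coe_int_num_of_den_eq_one hint
  have hcop : Nat.Coprime c.natAbs (bet n) := by
    refine Nat.coprime_of_dvd fun p hp h1 h2 => ?_
    have : Fact p.Prime := ⟨hp⟩
    rw [bet, Prime.dvd_finset_prod_iff hp.prime] at h2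
    obtain ⟨q, hq, hd⟩ := h2
    have hq' := (mem_primeSet hn).1 hq
    have hpq := (Nat.prime_dvd_prime_iff_eq hp hq'.1).1 (hp.dvd_of_dvd_pow hd)
    subst hpq
    have h3 := norm_bet_mul hn hq'.2
    rw [← hcq, padicNorm.int_eq_one_iff] at h3
    exact h3 (Int.natCast_dvd.2 h1)
  have hbet : ((bet n : ℤ) : ℚ) ≠ 0 := by exact_mod_cast (bet_pos n).ne'
  have hx : absb n = (c : ℚ) / ((bet n : ℤ) : ℚ) := by
    rw [hcq, eq_div_iff hbet]; push_cast; rfl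
  have hnum : (absb n).num = c := by
    rw [hx]
    exact Rat.num_div_eq_of_coprime (by exact_mod_cast bet_pos n) (by simpa using hcop)
  have hcpos : 0 ≤ c := by rw [← hnum]; exact (Rat.num_pos.2 hbpos).le
  have : bernoulliTau n = c.natAbs := by rw [← hnum]; rfl
  rw [this, ← hcq]
  have : ((c.natAbs : ℤ) : ℚ) = (c : ℚ) := by rw [Int.natAbs_of_nonneg hcpos]
  rw [← Int.cast_natCast]
  exact this

lemma pow_dvd_of_dvd_not {p c d k : ℕ} (hp : p.Prime) (hd0 : d ≠ 0) (h1 : d ∣ p ^ (k + 1) * c)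
    (h2 : ¬ d ∣ p ^ k * c) : p ^ (k + 1) ∣ d := by
  obtain ⟨t, d', hd', rfl⟩ := Nat.exists_eq_pow_mul_and_not_dvd hd0 p hp.ne_one
  by_contra hc
  have ht : t ≤ k := by
    by_contra ht
    exact hc ((pow_dvd_pow p (by omega)).mul_right _)
  apply h2
  refine mul_dvd_mul (pow_dvd_pow p ht) ?_
  refine Nat.Coprime.dvd_of_dvd_mul_left ?_ ((dvd_mul_left _ _).trans h1)
  exact Nat.Coprime.pow_right _ (Nat.Coprime.symm ((Nat.Prime.coprime_iff_not_dvd hp).2 hd'))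

lemma betR_congr {p k m : ℕ} [hp : Fact p.Prime] (hm : 1 ≤ m) :
    (p : ℤ) ^ (k + 1) ∣ (betR p (p ^ (k + 1) * m) : ℤ) - betR p (p ^ k * m) := by
  have hpp := hp.out.pos
  have hn : 1 ≤ p ^ (k + 1) * m := Nat.mul_pos (pow_pos hpp _) hm
  have hn' : 1 ≤ p ^ k * m := Nat.mul_pos (pow_pos hpp _) hm
  have hval : ∀ q j : ℕ, q.Prime → q ≠ p →
      padicValNat q (2 * (p ^ j * m)) = padicValNat q (2 * m) := by
    intro q j hq hqp
    have : Fact q.Prime := ⟨hq⟩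
    rw [show 2 * (p ^ j * m) = p ^ j * (2 * m) by ring, padicValNat.mul (by positivity) (by omega),
      padicValNat.pow, padicValNat_primes hqp]
    simp
  have hR : ∀ j, ((betR p (p ^ j * m) : ℕ) : ZMod (p ^ (k + 1))) =
      ∏ q ∈ (primeSet (p ^ j * m)).erase p, (q : ZMod (p ^ (k + 1))) ^ (1 + padicValNat q (2 * m)) := by
    intro j
    rw [betR]
    push_cast
    refine Finset.prod_congr rfl fun q hq => ?_
    have hq' := Finset.mem_erase.1 hq
    rw [hval q j (Finset.mem_filter.1 hq'.2).2.1 hq'.1]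
  have key : ((betR p (p ^ (k + 1) * m) : ℕ) : ZMod (p ^ (k + 1))) = (betR p (p ^ k * m) : ℕ) := by
    rw [hR, hR]
    symm
    refine Finset.prod_subset ?_ ?_
    · intro q hq
      rw [Finset.mem_erase, mem_primeSet hn'] at hq
      rw [Finset.mem_erase, mem_primeSet hn]
      refine ⟨hq.1, hq.2.1, hq.2.2.trans ?_⟩
      exact mul_dvd_mul_left 2 (mul_dvd_mul_right (pow_dvd_pow p (by omega)) m)
    · intro q hq hq'
      rw [Finset.mem_erase, mem_primeSet hn] at hq
      rw [Finset.mem_erase, mem_primeSet hn'] at hq'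
      have h2 : ¬ q - 1 ∣ 2 * (p ^ k * m) := fun h => hq' ⟨hq.1, hq.2.1, h⟩
      have h1 := hq.2.2
      rw [mul_left_comm] at h1 h2
      have hq2 := hq.2.1.two_le
      have h3 := pow_dvd_of_dvd_not hp.out (by omega) h1 h2
      have h4 : ((q - 1 : ℕ) : ZMod (p ^ (k + 1))) = 0 := (ZMod.natCast_eq_zero_iff _ _).2 h3
      have h5 : (q : ZMod (p ^ (k + 1))) = 1 := by
        have : q = (q - 1) + 1 := by omega
        rw [this]; push_cast; rw [h4, zero_add]
      rw [h5, one_pow]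
  have := (ZMod.natCast_eq_natCast_iff _ _ _).1 key.symm
  have := Nat.modEq_iff_dvd.1 this
  exact_mod_cast this

lemma pow_congr {p k m : ℕ} [hp : Fact p.Prime] (hm : 1 ≤ m) (x : ℤ) :
    (p : ℤ) ^ (k + 1) ∣ x ^ (2 * (p ^ (k + 1) * m) - 1) - x ^ (2 * (p ^ k * m) - 1) := by
  have hp2 := hp.out.two_le
  have hk : k + 1 ≤ p ^ k := by
    have : k < 2 ^ k := Nat.lt_two_pow_self
    have := Nat.pow_le_pow_left hp2 k
    omega
  have h1 : p ^ k ≤ p ^ k * m := Nat.le_mul_of_pos_right _ hm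
  have hle : p ^ k * m ≤ p ^ (k + 1) * m :=
    Nat.mul_le_mul_right m (Nat.pow_le_pow_right hp.out.pos (by omega))
  by_cases hx : (p : ℤ) ∣ x
  · refine dvd_sub ?_ ?_
    · exact (pow_dvd_pow _ (by omega)).trans (pow_dvd_pow_of_dvd hx _)
    · exact (pow_dvd_pow _ (by omega)).trans (pow_dvd_pow_of_dvd hx _)
  · have e : 2 * (p ^ (k + 1) * m) - 1 = (2 * (p ^ k * m) - 1) + (p ^ (k + 1)).totient * (2 * m) := by
      rw [Nat.totient_prime_pow_succ hp.out]
      obtain ⟨q, rfl⟩ : ∃ q, p = q + 1 := ⟨p - 1, by omega⟩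
      have : 2 * ((q + 1) ^ (k + 1) * m) = 2 * ((q + 1) ^ k * m) + (q + 1) ^ k * q * (2 * m) := by ring
      rw [this, Nat.add_sub_cancel]
      omega
    rw [e, pow_add x, pow_mul x]
    have hcop : IsCoprime x ((p ^ (k + 1) : ℕ) : ℤ) := by
      push_cast
      refine IsCoprime.pow_right ?_
      exact ((Prime.coprime_iff_not_dvd (Nat.prime_iff_prime_int.1 hp.out)).2 hx).symm
    have h2 : x ^ (p ^ (k + 1)).totient ≡ 1 [ZMOD (p ^ (k + 1) : ℕ)] := by
      rw [← ZMod.intCast_eq_intCast_iff]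
      obtain ⟨u, v, huv⟩ := hcop
      have h := congrArg (fun z : ℤ => (z : ZMod (p ^ (k + 1)))) huv
      simp only [Int.cast_add, Int.cast_mul, Int.cast_natCast, ZMod.natCast_self, mul_zero,
        add_zero, Int.cast_one] at h
      have hu : IsUnit ((x : ℤ) : ZMod (p ^ (k + 1))) := IsUnit.of_mul_eq_one _ ((mul_comm _ _).trans h)
      obtain ⟨w, hw⟩ := hu
      have h0 := congrArg Units.val (ZMod.pow_totient w)
      rw [Units.val_pow_eq_pow_val, hw, Units.val_one] at h0
      rw [Int.cast_pow, Int.cast_one]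
      exact h0
    have h3 := h2.pow (2 * m)
    rw [one_pow] at h3
    have h4 := h3.symm.dvd
    push_cast at h4
    have := h4.mul_left (x ^ (2 * (p ^ k * m) - 1))
    rwa [mul_sub, mul_one] at this

lemma tau_congr (p k m : ℕ) (hp : p.Prime) (hm : 1 ≤ m) :
    ((p : ℤ) ^ (k + 1)) ∣ (bernoulliTau (p ^ (k + 1) * m) : ℤ) - bernoulliTau (p ^ k * m) := by
  have : Fact p.Prime := ⟨hp⟩
  set n := p ^ (k + 1) * m with hn
  set n' := p ^ k * m with hn'
  have hn1 : 1 ≤ n := Nat.mul_pos (pow_pos hp.pos _) hm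
  have hn1' : 1 ≤ n' := Nat.mul_pos (pow_pos hp.pos _) hm
  have hnn' : n = p * n' := by rw [hn, hn']; ring
  have hpq : (p : ℚ) ≠ 0 := PD.p_pos.ne'
  have hmq : (m : ℚ) ≠ 0 := by positivity
  set x : ℚ := bernoulli (2 * n) / (2 * n : ℚ) * bet n with hx
  set y : ℚ := bernoulli (2 * n') / (2 * n' : ℚ) * bet n' with hy
  have hRz : PD p ((k + 1 : ℕ) : ℤ) ((betR p n : ℚ) - betR p n') := by
    have := (PD.int_iff (p := p) (k + 1) _).2 (betR_congr (p := p) (k := k) hm)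
    push_cast at this ⊢
    exact this
  -- the general product step
  have hprod : ∀ u v : ℚ, PD p ((k + 1 : ℕ) : ℤ) (u - v) → PD p 0 v →
      PD p ((k + 1 : ℕ) : ℤ) (u * betR p n - v * betR p n') := by
    intro u v huv hv
    have h1 := (huv.mul (PD.nat (p := p) (betR p n))).add ((hRz.mul hv).mono (by omega))
    rw [add_zero] at h1
    convert h1 using 1
    ring
  have hxy : PD p ((k + 1 : ℕ) : ℤ) (x - y) := by
    by_cases h : (p - 1) ∣ 2 * n'
    · have h' : (p - 1) ∣ 2 * n := by
        rw [hnn', mul_left_comm]; exact h.mul_left p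
      have hval : ∀ j, padicValNat p (2 * (p ^ j * m)) = j + padicValNat p (2 * m) := by
        intro j
        rw [mul_left_comm, padicValNat.mul (pow_ne_zero _ hp.ne_zero) (by omega),
          padicValNat.prime_pow]
      set w := padicValNat p (2 * m) with hw
      have hX : ∀ j, (p - 1) ∣ 2 * (p ^ j * m) →
          bernoulli (2 * (p ^ j * m)) / (2 * (p ^ j * m : ℕ) : ℚ) * bet (p ^ j * m) =
          (((p : ℚ) ^ w / (2 * m : ℕ)) * (p * bernoulli (2 * (p ^ j * m)))) * betR p (p ^ j * m) := by
        intro j hj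
        rw [bet_eq_B (p := p) (Nat.mul_pos (pow_pos hp.pos _) hm) hj, hval j]
        push_cast
        field_simp
        ring
      rw [hx, hy, hX _ h', hX _ h]
      have hW : PD p 0 ((p : ℚ) ^ w / (2 * m : ℕ)) := by
        unfold PD
        rw [hw, norm_nat_pow_val _ (by omega)]; simp
      have hpb : ∀ N, PD p 0 ((p : ℚ) * bernoulli N) := by
        intro N
        have := (PD.p_pow (p := p) 1).mul (PD.bernoulli N)
        simpa using this
      refine hprod _ _ ?_ ?_
      · have c1 : PD p ((k + 1 : ℕ) : ℤ) (p * bernoulli (2 * n) - (p - 1)) := by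
          refine caseB (by omega) (by omega) h' ?_ ?_
          · rw [hn]
            exact (Dvd.intro (p * m) (by simp; ring)).mul_left 2
          · rintro rfl
            exact (Dvd.intro _ rfl).mul_left 2
        have c2 : PD p ((k + 1 : ℕ) : ℤ) (p * bernoulli (2 * n') - (p - 1)) := by
          refine caseB (by omega) (by omega) h ?_ ?_
          · exact (Dvd.intro _ rfl).mul_left 2
          · rintro rfl
            rw [hn']
            exact Dvd.intro m (by ring)
        have := hW.mul (c1.sub c2)
        rw [zero_add] at this
        convert this using 1
        ring
      · exact hW.mul (hpb _)
    · have h' : ¬ (p - 1) ∣ 2 * n := by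
        intro hd
        apply h
        rw [hnn', mul_left_comm] at hd
        refine Nat.Coprime.dvd_of_dvd_mul_left ?_ hd
        exact Nat.Coprime.symm ((Nat.coprime_self_sub_right hp.one_le).2 (by simp))
      rw [hx, hy, bet_eq_A (p := p) h, bet_eq_A (p := p) h']
      have hk := kummer (p := p) (n := 2 * n - 1) (n' := 2 * n' - 1) (k := k + 1)
        (fun x => pow_congr hm x) (by omega) (by rwa [show 2 * n - 1 + 1 = 2 * n by omega])
      have e : ∀ n : ℕ, 1 ≤ n → ((2 * n - 1 : ℕ) : ℚ) + 1 = 2 * n := by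
        intro n hn
        have : 2 * n - 1 + 1 = 2 * n := by omega
        exact_mod_cast this
      rw [show 2 * n - 1 + 1 = 2 * n by omega, show 2 * n' - 1 + 1 = 2 * n' by omega, e n hn1,
        e n' hn1'] at hk
      exact hprod _ _ hk.1 hk.2.2
  have htx : (bernoulliTau n : ℚ) = (-1) ^ (n + 1) * x := by
    rw [tau_eq n hn1, absb_eq n hn1, hx]; ring
  have hty : (bernoulliTau n' : ℚ) = (-1) ^ (n' + 1) * y := by
    rw [tau_eq n' hn1', absb_eq n' hn1', hy]; ring
  rw [← PD.int_iff]
  push_cast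
  have hsq : ∀ j : ℕ, ((-1 : ℚ) ^ j) * (-1) ^ j = 1 := by
    intro j; rw [← mul_pow]; norm_num
  have hsgn : ∀ j : ℕ, PD p 0 ((-1 : ℚ) ^ j) := by
    intro j
    have := PD.int (p := p) ((-1) ^ j)
    push_cast at this
    exact this
  have hgood : (-1 : ℚ) ^ (n + 1) = (-1) ^ (n' + 1) →
      PD p ((k + 1 : ℕ) : ℤ) ((bernoulliTau n : ℚ) - bernoulliTau n') := by
    intro hs
    rw [htx, hty, hs, ← mul_sub]
    have := (hsgn (n' + 1)).mul hxy
    rwa [zero_add] at this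
  rcases hp.eq_two_or_odd' with h2 | hodd
  · rcases Nat.eq_zero_or_pos k with hk0 | hkpos
    · have h1 : PD p ((k + 1 : ℕ) : ℤ) ((-1) ^ (n + 1) * (x - y)) := by
        have := (hsgn (n + 1)).mul hxy
        rwa [zero_add] at this
      have hpar : (-1 : ℚ) ^ (n + 1) = (-1) ^ (n' + 1) ∨ (-1 : ℚ) ^ (n + 1) = -(-1) ^ (n' + 1) := by
        rcases neg_one_pow_eq_or ℚ (n + 1) with h | h <;>
        rcases neg_one_pow_eq_or ℚ (n' + 1) with h' | h' <;> rw [h, h'] <;> norm_num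
      rcases hpar with hs | hs
      · exact_mod_cast hgood hs
      · have e : (bernoulliTau n : ℚ) - bernoulliTau n' =
            (-1) ^ (n + 1) * (x - y) - 2 * bernoulliTau n' := by
          rw [htx, hty, hs]; ring
        have h3 : PD p ((k + 1 : ℕ) : ℤ) (2 * (bernoulliTau n' : ℚ)) := by
          have := (PD.p_pow (p := p) 1).mul (PD.nat (p := p) (bernoulliTau n'))
          rw [hk0]
          rw [h2] at this ⊢
          simpa using this
        rw [e]
        exact_mod_cast h1.sub h3
    · have hev : Even n' := by
        rw [hn', h2]
        exact (Nat.even_pow.2 ⟨even_two, by omega⟩).mul_right m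
      have hev' : Even n := by rw [hnn']; exact hev.mul_left p
      exact_mod_cast hgood (by rw [hev.add_one.neg_one_pow, hev'.add_one.neg_one_pow])
  · have hs : (-1 : ℚ) ^ (n + 1) = (-1) ^ (n' + 1) := by
      rw [hnn', pow_succ, pow_mul, hodd.neg_one_pow, pow_succ]
    exact_mod_cast hgood hs

end Final

theorem bernoulli_numerators_realizable : IsRealizable bernoulliTau := by
  refine realizable_of_dold _ (dold_nonneg bet tau_eq bet_mono) (dold_dvd _ ?_)
  intro p k m hp hm _
  exact tau_congr p k m hp hm
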